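/- arXiv:2508.03282 — 4 statements merged into one kernel-verified Lean document; each statement's English description precedes it below -/
import Mathlib

section
/- Orthogonality in the propensity/sampling-score directions (vanishing residual term): let Y : Ω → ℝ be integrable, e_S(X) a version of ℙ(A=1 ∣ σ(X)) with δ ≤ e_S(X) ≤ 1 − δ ℙ-almost surely for some δ ∈ (0, 1/2), and for a ∈ {0,1} let mₐ(X) be a version of 𝔼[Y ∣ X, A=a] under ℙ. Then for every bounded measurable h : ℝ^p → ℝ, 𝔼[ ( A·(Y − m₁(X))/e_S(X) + (1−A)·(Y − m₀(X))/(1 − e_S(X)) )·h(X) ] = 0. -/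
open MeasureTheory ProbabilityTheory


/-- `v ∘ X` is a version of `𝔼_Q[W ∣ X]` on the event where the (real-valued) indicator `ind`
equals one: for every bounded measurable `h : ℝ^p → ℝ`,
`𝔼_Q[ind · W · h(X)] = 𝔼_Q[ind · v(X) · h(X)]`.  Versions of conditional expectations
`𝔼_Q[Y ∣ X, A = a]` are obtained with `ind = 1{A=a}` and `W = Y`; versions of conditional
probabilities such as `Q(R=1 ∣ σ(X))` are obtained with `ind = 1` and `W = 1{R=1}`. -/
def IsCondVersion {Ω : Type*} [MeasurableSpace Ω] {p : ℕ} (Q : Measure Ω)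
    (X : Ω → Fin p → ℝ) (ind : Ω → ℝ) (W : Ω → ℝ) (v : (Fin p → ℝ) → ℝ) : Prop :=
  Measurable v ∧ ∀ h : (Fin p → ℝ) → ℝ, Measurable h → (∃ C, ∀ x, |h x| ≤ C) →
    ∫ ω, ind ω * W ω * h (X ω) ∂Q = ∫ ω, ind ω * v (X ω) * h (X ω) ∂Q


/-- The regression function is automatically integrable on the event, and the residual is
orthogonal to every bounded function of `X`. -/
lemma resid_aux {Ω : Type*} [MeasurableSpace Ω]
    (P : Measure Ω) [IsProbabilityMeasure P] {p : ℕ}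
    (X : Ω → Fin p → ℝ) (hX : Measurable X)
    (A : Ω → ℝ) (hA : Measurable A) (hA01 : ∀ ω, A ω = 0 ∨ A ω = 1)
    (Y : Ω → ℝ) (hYint : Integrable Y P)
    (m : (Fin p → ℝ) → ℝ) (hm : IsCondVersion P X A Y m)
    (g : (Fin p → ℝ) → ℝ) (hg : Measurable g) (hgb : ∃ C, ∀ x, |g x| ≤ C) :
    Integrable (fun ω => A ω * (Y ω - m (X ω)) * g (X ω)) P ∧
      ∫ ω, A ω * (Y ω - m (X ω)) * g (X ω) ∂P = 0 := by
  obtain ⟨hmm, hmv⟩ := hm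
  have hmX : Measurable (fun ω => m (X ω)) := hmm.comp hX
  have hAb : ∀ ω, |A ω| ≤ 1 := fun ω => by
    rcases hA01 ω with h | h <;> simp [h]
  have hAY : Integrable (fun ω => A ω * Y ω) P :=
    hYint.bdd_mul hA.aestronglyMeasurable (c := 1) (Filter.Eventually.of_forall hAb)
  have hAm : Integrable (fun ω => A ω * m (X ω)) P := by
    let S : ℕ → Set Ω := fun n => {ω | |m (X ω)| ≤ n}
    have hS : ∀ n, MeasurableSet (S n) := fun n =>
      measurableSet_le hmX.abs measurable_const
    have hcov : AECover P Filter.atTop S := by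
      refine ⟨Filter.Eventually.of_forall fun ω => ?_, hS⟩
      obtain ⟨N, hN⟩ := exists_nat_ge |m (X ω)|
      filter_upwards [Filter.eventually_ge_atTop N] with n hn
      exact hN.trans (by exact_mod_cast hn)
    refine hcov.integrable_of_integral_norm_bounded (∫ ω, |A ω * Y ω| ∂P) ?_
      (Filter.Eventually.of_forall ?_)
    · intro n
      refine Measure.integrableOn_of_bounded (M := n) (measure_ne_top _ _)
        (hA.mul hmX).aestronglyMeasurable ?_
      refine (ae_restrict_iff' (hS n)).2 (Filter.Eventually.of_forall fun ω hω => ?_)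
      have h1 : |m (X ω)| ≤ n := hω
      rw [Real.norm_eq_abs, abs_mul]
      nlinarith [hAb ω, abs_nonneg (A ω), abs_nonneg (m (X ω))]
    · intro n
      let k : (Fin p → ℝ) → ℝ := fun x =>
        if |m x| ≤ n then (if 0 ≤ m x then 1 else -1) else 0
      have hk : Measurable k :=
        Measurable.ite (measurableSet_le hmm.abs measurable_const)
          (Measurable.ite (measurableSet_le measurable_const hmm) measurable_const
            measurable_const) measurable_const
      have hkb : ∀ x, |k x| ≤ 1 := by
        intro x
        simp only [k]
        split_ifs <;> simp
      have e := hmv k hk ⟨1, hkb⟩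
      have e2 : ∫ ω in S n, ‖A ω * m (X ω)‖ ∂P = ∫ ω, A ω * m (X ω) * k (X ω) ∂P := by
        rw [← integral_indicator (hS n)]
        congr 1
        ext ω
        by_cases h1 : |m (X ω)| ≤ n
        · rw [Set.indicator_of_mem (show ω ∈ S n from h1)]
          rcases hA01 ω with h | h
          · simp [h]
          · by_cases h2 : 0 ≤ m (X ω)
            · simp only [k, h, if_pos h1, if_pos h2, one_mul, mul_one, Real.norm_eq_abs,
                abs_of_nonneg h2]
            · simp only [k, h, if_pos h1, if_neg h2, one_mul, mul_neg, mul_one,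
                Real.norm_eq_abs, abs_of_neg (not_le.1 h2)]
        · rw [Set.indicator_of_notMem (show ω ∉ S n from h1)]
          simp [k, h1]
      rw [e2, ← e]
      refine (le_abs_self _).trans ((abs_integral_le_integral_abs).trans ?_)
      refine integral_mono_of_nonneg (Filter.Eventually.of_forall fun ω => abs_nonneg _)
        hAY.abs (Filter.Eventually.of_forall fun ω => ?_)
      show |A ω * Y ω * k (X ω)| ≤ |A ω * Y ω|
      rw [abs_mul]
      exact mul_le_of_le_one_right (abs_nonneg _) (hkb _)
  have e := hmv g hg hgb
  obtain ⟨C, hC⟩ := hgb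
  have hgX : AEStronglyMeasurable (fun ω => g (X ω)) P := (hg.comp hX).aestronglyMeasurable
  have i1 : Integrable (fun ω => A ω * Y ω * g (X ω)) P :=
    hAY.mul_bdd (c := C) hgX (Filter.Eventually.of_forall fun ω => hC _)
  have i2 : Integrable (fun ω => A ω * m (X ω) * g (X ω)) P :=
    hAm.mul_bdd (c := C) hgX (Filter.Eventually.of_forall fun ω => hC _)
  have heq : (fun ω => A ω * (Y ω - m (X ω)) * g (X ω)) =
      fun ω => A ω * Y ω * g (X ω) - A ω * m (X ω) * g (X ω) := by
    ext ω; ring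
  rw [heq]
  exact ⟨i1.sub i2, by rw [integral_sub i1 i2, e, sub_self]⟩

/-- Orthogonality in the propensity/sampling-score directions
(vanishing residual term). -/
theorem orthogonality_score_direction {Ω : Type*} [MeasurableSpace Ω]
    (P : Measure Ω) [IsProbabilityMeasure P]
    (p : ℕ) (hp : 1 ≤ p)
    (X : Ω → Fin p → ℝ) (hX : Measurable X)
    (A : Ω → ℝ) (hA : Measurable A)
    (hA01 : ∀ ω, A ω = 0 ∨ A ω = 1)
    (Y : Ω → ℝ) (hYm : Measurable Y) (hYint : Integrable Y P)
    -- e_S is a version of P(A=1 ∣ σ(X)), bounded away from 0 and 1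
    (eS : (Fin p → ℝ) → ℝ) (heS : IsCondVersion P X (fun _ => 1) A eS)
    (δ : ℝ) (hδ : δ ∈ Set.Ioo (0 : ℝ) (1 / 2))
    (heSbd : ∀ᵐ ω ∂P, δ ≤ eS (X ω) ∧ eS (X ω) ≤ 1 - δ)
    -- outcome regression functions under P
    (m₀ m₁ : (Fin p → ℝ) → ℝ)
    (hm₀ : IsCondVersion P X (fun ω => 1 - A ω) Y m₀)
    (hm₁ : IsCondVersion P X A Y m₁) :
    ∀ h : (Fin p → ℝ) → ℝ, Measurable h → (∃ C, ∀ x, |h x| ≤ C) →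
      ∫ ω, (A ω * (Y ω - m₁ (X ω)) / eS (X ω)
            + (1 - A ω) * (Y ω - m₀ (X ω)) / (1 - eS (X ω))) * h (X ω) ∂P = 0 := by
  intro h hh ⟨C, hC⟩
  obtain ⟨hδ0, -⟩ := hδ
  have key : ∀ d : (Fin p → ℝ) → ℝ, Measurable d →
      Measurable (fun x => if δ ≤ d x then h x / d x else 0) ∧
      ∃ C', ∀ x, |(if δ ≤ d x then h x / d x else 0)| ≤ C' := by
    intro d hd
    refine ⟨Measurable.ite (measurableSet_le measurable_const hd) (hh.div hd)
      measurable_const, C / δ, fun x => ?_⟩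
    have hC0 : 0 ≤ C := (abs_nonneg _).trans (hC x)
    split_ifs with hx
    · rw [abs_div, abs_of_pos (hδ0.trans_le hx)]
      exact div_le_div₀ hC0 (hC x) hδ0 hx
    · simpa using div_nonneg hC0 hδ0.le
  obtain ⟨k1, k1b⟩ := key eS heS.1
  obtain ⟨k0, k0b⟩ := key (fun x => 1 - eS x) (measurable_const.sub heS.1)
  obtain ⟨i1, e1⟩ := resid_aux P X hX A hA hA01 Y hYint m₁ hm₁ _ k1 k1b
  obtain ⟨i0, e0⟩ := resid_aux P X hX (fun ω => 1 - A ω) (measurable_const.sub hA)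
    (fun ω => by rcases hA01 ω with h | h <;> simp [h]) Y hYint m₀ hm₀ _ k0 k0b
  have e2 := integral_add i1 i0
  rw [e1, e0, add_zero] at e2
  refine Eq.trans (integral_congr_ae ?_) e2
  filter_upwards [heSbd] with ω hω
  have h1 : δ ≤ 1 - eS (X ω) := by linarith [hω.2]
  simp only [hω.1, h1, if_true]
  ring
end

section
/- Centering of the tangent-space component (the identity 𝔼[t(X)] = 0 in the proof of Lemma 1): assume A ≤ R ℙ-almost surely; under ℙ₁ = ℙ(· ∣ R=1), A is conditionally independent of (Y(0), Y(1)) given σ(X); under ℙ, R is conditionally independent of Y(0) given σ(X); and there is δ ∈ (0, 1/2) with δ ≤ e₁(X) ≤ 1 − δ and π(X) ≥ δ ℙ-almost surely, where e₁(X) is a version of ℙ₁(A=1 ∣ σ(X)) and π(X) a version of ℙ(R=1 ∣ σ(X)). Let mₐ(X) be a version of 𝔼[Y ∣ X, A=a] under ℙ (a = 0, 1). Then 𝔼[ π(X)·( m₁(X) − m₀(X) ) ] = q·𝔼[Y(1) − Y(0) ∣ R=1]. -/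
open MeasureTheory ProbabilityTheory

/-- Any conditional measure of a finite measure is a finite measure. -/
instance cond_isFiniteMeasure {Ω : Type*} [MeasurableSpace Ω] (μ : Measure Ω)
    [IsFiniteMeasure μ] (s : Set Ω) : IsFiniteMeasure (μ[|s]) := by
  constructor
  rw [ProbabilityTheory.cond, Measure.smul_apply, Measure.restrict_apply MeasurableSet.univ,
    Set.univ_inter, smul_eq_mul]
  exact lt_of_le_of_lt (ENNReal.inv_mul_le_one _) ENNReal.one_lt_top

section Helpers

open MeasureTheory ProbabilityTheory

/-- Two versions agree almost surely on the event `ind = 1`. -/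
theorem aux_pin {Ω : Type*} [MeasurableSpace Ω] {p : ℕ} (Q : Measure Ω) [IsFiniteMeasure Q]
    (X : Ω → Fin p → ℝ) (hX : Measurable X) (ind : Ω → ℝ) (hi : Measurable ind)
    (hi01 : ∀ ω, ind ω = 0 ∨ ind ω = 1)
    (v w : (Fin p → ℝ) → ℝ) (hv : Measurable v) (hw : Measurable w)
    (H : ∀ h : (Fin p → ℝ) → ℝ, Measurable h → (∃ C, ∀ x, |h x| ≤ C) →
      ∫ ω, ind ω * v (X ω) * h (X ω) ∂Q = ∫ ω, ind ω * w (X ω) * h (X ω) ∂Q) :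
    ∀ᵐ ω ∂Q, ind ω * (v (X ω) - w (X ω)) = 0 := by
  have key : ∀ n : ℕ, ∀ᵐ ω ∂Q, |v (X ω)| ≤ n ∧ |w (X ω)| ≤ n →
      ind ω * (v (X ω) - w (X ω)) = 0 := by
    intro n
    let B : Set (Fin p → ℝ) := {x | |v x| ≤ n ∧ |w x| ≤ n}
    have hB : MeasurableSet B :=
      (measurableSet_le hv.abs measurable_const).inter (measurableSet_le hw.abs measurable_const)
    let h : (Fin p → ℝ) → ℝ := B.indicator (fun x => v x - w x)
    have hh : Measurable h := (hv.sub hw).indicator hB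
    have hin : ∀ x ∈ B, h x = v x - w x := fun x hx => Set.indicator_of_mem hx _
    have hout : ∀ x, x ∉ B → h x = 0 := fun x hx => Set.indicator_of_notMem hx _
    have hb : ∀ x, |h x| ≤ 2 * n := by
      intro x
      by_cases hx : x ∈ B
      · rw [hin x hx]
        have h1 := hx.1
        have h2 := hx.2
        rw [abs_le] at *
        constructor <;> linarith
      · rw [hout x hx]; simp
    have hvh : ∀ x, |v x * h x| ≤ n * (2 * n) := by
      intro x
      by_cases hx : x ∈ B
      · rw [abs_mul]
        exact mul_le_mul hx.1 (hb x) (abs_nonneg _) (by positivity)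
      · rw [hout x hx]; simp; positivity
    have hwh : ∀ x, |w x * h x| ≤ n * (2 * n) := by
      intro x
      by_cases hx : x ∈ B
      · rw [abs_mul]
        exact mul_le_mul hx.2 (hb x) (abs_nonneg _) (by positivity)
      · rw [hout x hx]; simp; positivity
    have hi1 : ∀ ω, |ind ω| ≤ 1 := by
      intro ω
      rcases hi01 ω with h | h <;> simp [h]
    have I1 : Integrable (fun ω => ind ω * v (X ω) * h (X ω)) Q := by
      refine Integrable.of_bound (C := n * (2 * n)) (by fun_prop) (ae_of_all _ fun ω => ?_)
      rw [mul_assoc, Real.norm_eq_abs, abs_mul]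
      calc _ ≤ 1 * ((n : ℝ) * (2 * n)) :=
            mul_le_mul (hi1 ω) (hvh _) (abs_nonneg _) zero_le_one
        _ = _ := one_mul _
    have I2 : Integrable (fun ω => ind ω * w (X ω) * h (X ω)) Q := by
      refine Integrable.of_bound (C := n * (2 * n)) (by fun_prop) (ae_of_all _ fun ω => ?_)
      rw [mul_assoc, Real.norm_eq_abs, abs_mul]
      calc _ ≤ 1 * ((n : ℝ) * (2 * n)) :=
            mul_le_mul (hi1 ω) (hwh _) (abs_nonneg _) zero_le_one
        _ = _ := one_mul _
    have h0 : ∫ ω, (ind ω * v (X ω) * h (X ω) - ind ω * w (X ω) * h (X ω)) ∂Q = 0 := by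
      rw [integral_sub I1 I2, H h hh ⟨_, hb⟩, sub_self]
    have hnn : ∀ ω, 0 ≤ ind ω * v (X ω) * h (X ω) - ind ω * w (X ω) * h (X ω) := by
      intro ω
      by_cases hx : X ω ∈ B
      · rw [hin _ hx]
        rcases hi01 ω with h | h
        · simp [h]
        · rw [h]; nlinarith [sq_nonneg (v (X ω) - w (X ω))]
      · rw [hout _ hx]; simp
    have h1 := (integral_eq_zero_iff_of_nonneg hnn (I1.sub I2)).1 h0
    filter_upwards [h1] with ω hω hmem
    have hx : X ω ∈ B := hmem
    simp only [Pi.zero_apply] at hω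
    rw [hin _ hx] at hω
    rcases hi01 ω with h | h
    · simp [h]
    · rw [h] at hω ⊢
      have : (v (X ω) - w (X ω)) ^ 2 = 0 := by linarith
      rw [one_mul]
      exact pow_eq_zero_iff (two_ne_zero) |>.1 this
  filter_upwards [ae_all_iff.2 key] with ω hω
  obtain ⟨n, hn⟩ := exists_nat_ge (max |v (X ω)| |w (X ω)|)
  exact hω n ⟨(le_max_left _ _).trans hn, (le_max_right _ _).trans hn⟩

/-- Overlap removes the indicator. -/
theorem aux_overlap {Ω : Type*} [MeasurableSpace Ω] {p : ℕ} (Q : Measure Ω) [IsFiniteMeasure Q]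
    (X : Ω → Fin p → ℝ) (hX : Measurable X) (ind : Ω → ℝ)
    (e : (Fin p → ℝ) → ℝ) (he : Measurable e) (δ : ℝ) (hδ : 0 < δ)
    (hb : ∀ᵐ ω ∂Q, δ ≤ e (X ω) ∧ e (X ω) ≤ 1 - δ)
    (H : ∀ h : (Fin p → ℝ) → ℝ, Measurable h → (∃ C, ∀ x, |h x| ≤ C) →
      ∫ ω, ind ω * h (X ω) ∂Q = ∫ ω, e (X ω) * h (X ω) ∂Q)
    (f : (Fin p → ℝ) → ℝ) (hf : Measurable f) (hz : ∀ᵐ ω ∂Q, ind ω * f (X ω) = 0) :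
    ∀ᵐ ω ∂Q, f (X ω) = 0 := by
  let B : Set (Fin p → ℝ) := {x | f x ≠ 0}
  have hB : MeasurableSet B := (hf (measurableSet_singleton 0)).compl
  let h : (Fin p → ℝ) → ℝ := B.indicator (fun _ => 1)
  have hh : Measurable h := measurable_const.indicator hB
  have hin : ∀ x ∈ B, h x = 1 := fun x hx => Set.indicator_of_mem hx _
  have hout : ∀ x, x ∉ B → h x = 0 := fun x hx => Set.indicator_of_notMem hx _
  have hbd : ∀ x, |h x| ≤ 1 := by
    intro x
    by_cases hx : x ∈ B
    · rw [hin x hx]; simp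
    · rw [hout x hx]; simp
  have hh0 : ∀ x, 0 ≤ h x := by
    intro x
    by_cases hx : x ∈ B
    · rw [hin x hx]; simp
    · rw [hout x hx]
  have h0 : ∫ ω, e (X ω) * h (X ω) ∂Q = 0 := by
    rw [← H h hh ⟨1, hbd⟩]
    apply integral_eq_zero_of_ae
    filter_upwards [hz] with ω hω
    by_cases hx : X ω ∈ B
    · have : ind ω = 0 := (mul_eq_zero.1 hω).resolve_right hx
      simp [this]
    · simp [hout _ hx]
  have I : Integrable (fun ω => e (X ω) * h (X ω)) Q := by
    refine Integrable.of_bound (C := 1) (by fun_prop) ?_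
    filter_upwards [hb] with ω hω
    rw [Real.norm_eq_abs, abs_mul, abs_of_nonneg (hδ.le.trans hω.1)]
    exact mul_le_one₀ (by linarith [hω.2]) (abs_nonneg _) (hbd _)
  have hnn : 0 ≤ᵐ[Q] fun ω => e (X ω) * h (X ω) := by
    filter_upwards [hb] with ω hω
    exact mul_nonneg (hδ.le.trans hω.1) (hh0 _)
  have h1 := (integral_eq_zero_iff_of_nonneg_ae hnn I).1 h0
  filter_upwards [h1, hb] with ω hω hbω
  by_contra hne
  rw [hin _ hne] at hω
  simp only [mul_one, Pi.zero_apply] at hω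
  linarith [hbω.1]

theorem aux_tower {Ω : Type*} {m m0 : MeasurableSpace Ω} (hm : m ≤ m0) (Q : Measure Ω)
    [IsFiniteMeasure Q] (g Z : Ω → ℝ) (hg : StronglyMeasurable[m] g) (hZ : Integrable Z Q)
    (hgZ : Integrable (fun ω => g ω * Z ω) Q) :
    ∫ ω, g ω * Z ω ∂Q = ∫ ω, g ω * (Q[Z|m]) ω ∂Q := by
  have h1 : ∫ ω, (Q[fun ω => g ω * Z ω|m]) ω ∂Q = ∫ ω, g ω * Z ω ∂Q := integral_condExp hm
  rw [← h1]
  exact integral_congr_ae (condExp_mul_of_stronglyMeasurable_left hg hgZ hZ)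

theorem aux_ci {Ω : Type*} {m m0 : MeasurableSpace Ω} [StandardBorelSpace Ω] (hm : m ≤ m0)
    (Q : Measure Ω) [IsFiniteMeasure Q] (A Z : Ω → ℝ)
    (hA : Measurable A) (hZm : Measurable Z) (hA1 : ∀ ω, |A ω| ≤ 1) (hZ : Integrable Z Q)
    (hCI : CondIndepFun m hm A Z Q) :
    Q[fun ω => A ω * Z ω|m] =ᵐ[Q] fun ω => (Q[A|m]) ω * (Q[Z|m]) ω := by
  have hAi : Integrable A Q := Integrable.of_bound (by fun_prop) (C := 1) (ae_of_all _ hA1)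
  have hAZ : Integrable (fun ω => A ω * Z ω) Q :=
    hZ.bdd_mul (c := 1) (by fun_prop) (ae_of_all _ hA1)
  have h := (condIndepFun_iff_map_prod_eq_prod_map_map hA hZm).1 hCI
  have h' := ae_of_ae_trim hm h
  filter_upwards [h', condExp_ae_eq_integral_condExpKernel hm hAZ,
    condExp_ae_eq_integral_condExpKernel hm hAi, condExp_ae_eq_integral_condExpKernel hm hZ]
    with ω h1 h2 h3 h4
  rw [h2, h3, h4]
  rw [Kernel.map_apply _ (by fun_prop), Kernel.prod_apply, Kernel.map_apply _ hA,
    Kernel.map_apply _ hZm] at h1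
  have hi := (indepFun_iff_map_prod_eq_prod_map_map hA.aemeasurable hZm.aemeasurable).2 h1
  exact hi.integral_fun_mul_eq_mul_integral (by fun_prop) (by fun_prop)

theorem aux_ci_int {Ω : Type*} {m m0 : MeasurableSpace Ω} [StandardBorelSpace Ω] (hm : m ≤ m0)
    (Q : Measure Ω) [IsFiniteMeasure Q] (A Z : Ω → ℝ)
    (hA : Measurable A) (hZm : Measurable Z) (hA1 : ∀ ω, |A ω| ≤ 1) (hZ : Integrable Z Q)
    (hCI : CondIndepFun m hm A Z Q) (g : Ω → ℝ) (hg : StronglyMeasurable[m] g)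
    (C : ℝ) (hgC : ∀ ω, |g ω| ≤ C) :
    ∫ ω, A ω * Z ω * g ω ∂Q = ∫ ω, A ω * (Q[Z|m]) ω * g ω ∂Q := by
  have hAi : Integrable A Q := Integrable.of_bound (by fun_prop) (C := 1) (ae_of_all _ hA1)
  have hAZ : Integrable (fun ω => A ω * Z ω) Q :=
    hZ.bdd_mul (c := 1) (by fun_prop) (ae_of_all _ hA1)
  have hgm : AEStronglyMeasurable g Q := (hg.mono hm).aestronglyMeasurable
  have hgAZ : Integrable (fun ω => g ω * (A ω * Z ω)) Q :=
    hAZ.bdd_mul (c := C) hgm (ae_of_all _ hgC)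
  have hgE : Integrable (fun ω => g ω * (Q[Z|m]) ω) Q :=
    (integrable_condExp).bdd_mul (c := C) hgm (ae_of_all _ hgC)
  have hgEA : Integrable (fun ω => (g ω * (Q[Z|m]) ω) * A ω) Q :=
    hgE.mul_bdd (c := 1) (by fun_prop) (ae_of_all _ hA1)
  have e1 := aux_tower hm Q g _ hg hAZ hgAZ
  have e2 := aux_tower hm Q (fun ω => g ω * (Q[Z|m]) ω) A
    (hg.mul stronglyMeasurable_condExp) hAi hgEA
  calc _ = ∫ ω, g ω * (A ω * Z ω) ∂Q := by congr 1; ext ω; ring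
    _ = ∫ ω, (g ω * (Q[Z|m]) ω) * (Q[A|m]) ω ∂Q := by
      rw [e1]
      apply integral_congr_ae
      filter_upwards [aux_ci hm Q A Z hA hZm hA1 hZ hCI] with ω hω
      rw [hω]; ring
    _ = _ := by rw [← e2]; congr 1; ext ω; ring

end Helpers

/-- Centering of the tangent-space component:
`𝔼[π(X)·(m₁(X) − m₀(X))] = q·𝔼[Y(1) − Y(0) ∣ R=1]`. -/
theorem tangent_component_centering {Ω : Type*} [MeasurableSpace Ω] [StandardBorelSpace Ω]
    [Nonempty Ω]
    (P : Measure Ω) [IsProbabilityMeasure P]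
    (p : ℕ) (hp : 1 ≤ p)
    (X : Ω → Fin p → ℝ) (hX : Measurable X)
    (A R : Ω → ℝ) (hA : Measurable A) (hR : Measurable R)
    (hA01 : ∀ ω, A ω = 0 ∨ A ω = 1) (hR01 : ∀ ω, R ω = 0 ∨ R ω = 1)
    -- external-control units are never treated
    (hAR : ∀ᵐ ω ∂P, A ω ≤ R ω)
    (Y0 Y1 : Ω → ℝ) (hY0m : Measurable Y0) (hY1m : Measurable Y1)
    (hY0 : Integrable Y0 P) (hY1 : Integrable Y1 P)
    (Y : Ω → ℝ) (hY : ∀ ω, Y ω = A ω * Y1 ω + (1 - A ω) * Y0 ω)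
    (q : ℝ) (hq : P {ω | R ω = 1} = ENNReal.ofReal q) (hq0 : 0 < q) (hq1 : q < 1)
    -- strong ignorability: A ⫫ (Y(0), Y(1)) ∣ σ(X) under P₁ = P(⬝ ∣ R = 1)
    (hCI : CondIndepFun (MeasurableSpace.comap X inferInstance) hX.comap_le
      A (fun ω => (Y0 ω, Y1 ω)) (P[|{ω | R ω = 1}]))
    -- exchangeability: R ⫫ Y(0) ∣ σ(X) under P
    (hExch : CondIndepFun (MeasurableSpace.comap X inferInstance) hX.comap_le R Y0 P)
    -- overlap: δ ≤ e₁(X) ≤ 1 − δ and π(X) ≥ δ, P-a.s.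
    (δ : ℝ) (hδ : δ ∈ Set.Ioo (0 : ℝ) (1 / 2))
    (e₁ : (Fin p → ℝ) → ℝ)
    (he₁ : IsCondVersion (P[|{ω | R ω = 1}]) X (fun _ => 1) A e₁)
    (π : (Fin p → ℝ) → ℝ) (hπ : IsCondVersion P X (fun _ => 1) R π)
    (hbd : ∀ᵐ ω ∂P, (δ ≤ e₁ (X ω) ∧ e₁ (X ω) ≤ 1 - δ) ∧ δ ≤ π (X ω))
    -- pooled outcome regressions
    (m₀ m₁ : (Fin p → ℝ) → ℝ)
    (hm₀ : IsCondVersion P X (fun ω => 1 - A ω) Y m₀)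
    (hm₁ : IsCondVersion P X A Y m₁) :
    ∫ ω, π (X ω) * (m₁ (X ω) - m₀ (X ω)) ∂P =
      q * ∫ ω, (Y1 ω - Y0 ω) ∂(P[|{ω | R ω = 1}]) := by
  classical
  obtain ⟨hδ0, hδ1⟩ := hδ
  have hs : MeasurableSet {ω | R ω = 1} := hR (measurableSet_singleton 1)
  set s : Set Ω := {ω | R ω = 1} with hsdef
  have hm := hX.comap_le
  have hPs0 : P s ≠ 0 := by rw [hq]; simpa using hq0
  have hA1 : ∀ ω, |A ω| ≤ 1 := fun ω => by rcases hA01 ω with h | h <;> simp [h]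
  have hR1 : ∀ ω, |R ω| ≤ 1 := fun ω => by rcases hR01 ω with h | h <;> simp [h]
  have hind : ∀ f : Ω → ℝ, s.indicator f = fun ω => R ω * f ω := by
    intro f; ext ω
    by_cases h : ω ∈ s
    · have h' : R ω = 1 := h
      simp [h, h']
    · have h' : R ω = 0 := (hR01 ω).resolve_right h
      simp [h, h']
  have hcond : P[|s] = (P s)⁻¹ • P.restrict s := rfl
  set Q : Measure Ω := P[|s] with hQ
  have hQP : Q ≪ P := cond_absolutelyContinuous
  have hint : ∀ f : Ω → ℝ, ∫ ω, f ω ∂Q = q⁻¹ * ∫ ω, R ω * f ω ∂P := by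
    intro f
    rw [hcond, integral_smul_measure, ← integral_indicator hs, hind, hq, ENNReal.toReal_inv,
      ENNReal.toReal_ofReal hq0.le, smul_eq_mul]
  have hint' : ∀ f : Ω → ℝ, ∫ ω, R ω * f ω ∂P = q * ∫ ω, f ω ∂Q := by
    intro f
    rw [hint, mul_inv_cancel_left₀ hq0.ne']
  have hIQ : ∀ f : Ω → ℝ, Integrable f P → Integrable f Q := by
    intro f hf
    rw [hcond]
    exact hf.restrict.smul_measure (ENNReal.inv_ne_top.2 hPs0)
  have hIR : ∀ f : Ω → ℝ, Integrable f Q → Integrable (fun ω => R ω * f ω) P := by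
    intro f hf
    rw [hcond, integrable_smul_measure (ENNReal.inv_ne_zero.2 (measure_ne_top P s))
      (ENNReal.inv_ne_top.2 hPs0)] at hf
    rw [← hind, integrable_indicator_iff hs]
    exact hf
  have hsmX : ∀ h : (Fin p → ℝ) → ℝ, Measurable h → StronglyMeasurable[MeasurableSpace.comap X inferInstance] (fun ω => h (X ω)) :=
    fun h hh => (hh.comp (comap_measurable X)).stronglyMeasurable
  have hex : ∀ (μ : Measure Ω) (Z : Ω → ℝ), ∃ ν : (Fin p → ℝ) → ℝ, Measurable ν ∧
      ∀ ω, (μ[Z|MeasurableSpace.comap X inferInstance]) ω = ν (X ω) := by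
    intro μ Z
    obtain ⟨ν, hν, h⟩ := (stronglyMeasurable_condExp (μ := μ) (m := MeasurableSpace.comap X inferInstance)
      (f := Z)).measurable.exists_eq_measurable_comp
    exact ⟨ν, hν, fun ω => congrFun h ω⟩
  have hCI0 : CondIndepFun (MeasurableSpace.comap X inferInstance) hm A Y0 Q := hCI.comp measurable_id measurable_fst
  have hCI1 : CondIndepFun (MeasurableSpace.comap X inferInstance) hm A Y1 Q := hCI.comp measurable_id measurable_snd
  obtain ⟨ν₁, hν₁, hν₁e⟩ := hex Q Y1
  obtain ⟨μ₀, hμ₀, hμ₀e⟩ := hex Q Y0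
  obtain ⟨ν₀, hν₀, hν₀e⟩ := hex P Y0
  obtain ⟨ρ, hρ, hρe⟩ := hex P R
  have hbdQ : ∀ᵐ ω ∂Q, (δ ≤ e₁ (X ω) ∧ e₁ (X ω) ≤ 1 - δ) ∧ δ ≤ π (X ω) := hQP.ae_le hbd
  have hY0Q := hIQ _ hY0
  have hY1Q := hIQ _ hY1
  have iν₁ : Integrable (fun ω => ν₁ (X ω)) Q := by
    have : Integrable (Q[Y1|MeasurableSpace.comap X inferInstance]) Q := integrable_condExp
    exact this.congr (ae_of_all _ hν₁e)
  have iν₀ : Integrable (fun ω => ν₀ (X ω)) P := by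
    have : Integrable (P[Y0|MeasurableSpace.comap X inferInstance]) P := integrable_condExp
    exact this.congr (ae_of_all _ hν₀e)
  have iν₀Q := hIQ _ iν₀
  have iR : Integrable R P := Integrable.of_bound (by fun_prop) (C := 1) (ae_of_all _ hR1)
  -- the treated arm
  have hA1mul : ∀ ω, A ω * Y ω = A ω * Y1 ω := fun ω => by
    rcases hA01 ω with h | h <;> simp [hY, h]
  have hA0mul : ∀ ω, (1 - A ω) * Y ω = (1 - A ω) * Y0 ω := fun ω => by
    rcases hA01 ω with h | h <;> simp [hY, h]
  have hRA : ∀ᵐ ω ∂P, R ω * A ω = A ω := by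
    filter_upwards [hAR] with ω h
    rcases hA01 ω with h1 | h1
    · simp [h1]
    · rcases hR01 ω with h2 | h2
      · rw [h1, h2] at h; norm_num at h
      · simp [h1, h2]
  have hQA : ∀ f : Ω → ℝ, ∫ ω, A ω * f ω ∂Q = q⁻¹ * ∫ ω, A ω * f ω ∂P := by
    intro f
    rw [hint]
    congr 1
    apply integral_congr_ae
    filter_upwards [hRA] with ω h
    rw [← mul_assoc, h]
  have E1 : ∀ᵐ ω ∂Q, A ω * (m₁ (X ω) - ν₁ (X ω)) = 0 := by
    refine aux_pin Q X hX A hA hA01 m₁ ν₁ hm₁.1 hν₁ ?_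
    rintro h hh ⟨C, hC⟩
    have a1 := hm₁.2 h hh ⟨C, hC⟩
    have a2 := aux_ci_int hm Q A Y1 hA hY1m hA1 hY1Q hCI1 (fun ω => h (X ω)) (hsmX h hh) C
      (fun ω => hC _)
    simp only [hA1mul] at a1
    simp only [hν₁e] at a2
    rw [← a2]
    simp only [mul_assoc] at a1 ⊢
    rw [hQA, hQA, a1]
  have F1 : ∀ᵐ ω ∂Q, m₁ (X ω) - ν₁ (X ω) = 0 := by
    refine aux_overlap Q X hX A e₁ he₁.1 δ hδ0 (hbdQ.mono fun ω h => h.1) ?_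
      (fun x => m₁ x - ν₁ x) (hm₁.1.sub hν₁) E1
    intro h hh hC
    simpa using he₁.2 h hh hC
  -- the control arm
  have T0 : ∀ h : (Fin p → ℝ) → ℝ, Measurable h → (∃ C, ∀ x, |h x| ≤ C) →
      ∫ ω, Y0 ω * h (X ω) ∂Q = ∫ ω, ν₀ (X ω) * h (X ω) ∂Q := by
    rintro h hh ⟨C, hC⟩
    have a2 := aux_ci_int hm P R Y0 hR hY0m hR1 hY0 hExch (fun ω => h (X ω)) (hsmX h hh) C
      (fun ω => hC _)
    simp only [hν₀e, mul_assoc] at a2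
    rw [hint, hint, a2]
  have E0 : ∀ᵐ ω ∂Q, (1 : ℝ) * (ν₀ (X ω) - μ₀ (X ω)) = 0 := by
    refine aux_pin Q X hX (fun _ => 1) measurable_const (fun _ => Or.inr rfl) ν₀ μ₀ hν₀ hμ₀ ?_
    rintro h hh ⟨C, hC⟩
    have a := aux_tower hm Q (fun ω => h (X ω)) Y0 (hsmX h hh) hY0Q
      (hY0Q.bdd_mul (c := C) (hh.comp hX).aestronglyMeasurable (ae_of_all _ fun ω => hC _))
    simp only [hμ₀e] at a
    have b := T0 h hh ⟨C, hC⟩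
    simp only [one_mul]
    rw [← b]
    simp only [mul_comm _ (h _)]
    exact a
  have G0 : ∀ᵐ ω ∂P, (1 - A ω) * (m₀ (X ω) - ν₀ (X ω)) = 0 := by
    refine aux_pin P X hX (fun ω => 1 - A ω) (by fun_prop) (fun ω => ?_) m₀ ν₀ hm₀.1 hν₀ ?_
    · rcases hA01 ω with h | h <;> simp [h]
    rintro h hh ⟨C, hC⟩
    rw [← hm₀.2 h hh ⟨C, hC⟩]
    simp only [hA0mul]
    have hhm : AEStronglyMeasurable (fun ω => h (X ω)) P := (hh.comp hX).aestronglyMeasurable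
    have i1 : Integrable (fun ω => Y0 ω * h (X ω)) P :=
      hY0.mul_bdd (c := C) hhm (ae_of_all _ fun ω => hC _)
    have i2 : Integrable (fun ω => ν₀ (X ω) * h (X ω)) P :=
      iν₀.mul_bdd (c := C) hhm (ae_of_all _ fun ω => hC _)
    have i3 : Integrable (fun ω => A ω * (Y0 ω * h (X ω))) P :=
      i1.bdd_mul (c := 1) (by fun_prop) (ae_of_all _ hA1)
    have i4 : Integrable (fun ω => A ω * (ν₀ (X ω) * h (X ω))) P :=
      i2.bdd_mul (c := 1) (by fun_prop) (ae_of_all _ hA1)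
    -- full-population identity
    have b1 : ∫ ω, Y0 ω * h (X ω) ∂P = ∫ ω, ν₀ (X ω) * h (X ω) ∂P := by
      have a := aux_tower hm P (fun ω => h (X ω)) Y0 (hsmX h hh) hY0
        (hY0.bdd_mul (c := C) hhm (ae_of_all _ fun ω => hC _))
      simp only [hν₀e] at a
      simp only [mul_comm _ (h _)]
      exact a
    -- treated identity
    have b2 : ∫ ω, A ω * (Y0 ω * h (X ω)) ∂P = ∫ ω, A ω * (ν₀ (X ω) * h (X ω)) ∂P := by
      have a2 := aux_ci_int hm Q A Y0 hA hY0m hA1 hY0Q hCI0 (fun ω => h (X ω)) (hsmX h hh) C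
        (fun ω => hC _)
      simp only [hμ₀e] at a2
      have a3 : ∫ ω, A ω * μ₀ (X ω) * h (X ω) ∂Q = ∫ ω, A ω * ν₀ (X ω) * h (X ω) ∂Q := by
        apply integral_congr_ae
        filter_upwards [E0] with ω hω
        have : ν₀ (X ω) = μ₀ (X ω) := by linarith
        simp only [this]
      rw [a3] at a2
      simp only [mul_assoc] at a2
      rw [hQA, hQA] at a2
      exact mul_left_cancel₀ (inv_ne_zero hq0.ne') a2
    calc _ = ∫ ω, (Y0 ω * h (X ω) - A ω * (Y0 ω * h (X ω))) ∂P := by congr 1; ext ω; ring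
      _ = ∫ ω, (ν₀ (X ω) * h (X ω) - A ω * (ν₀ (X ω) * h (X ω))) ∂P := by
        rw [integral_sub i1 i3, integral_sub i2 i4, b1, b2]
      _ = _ := by congr 1; ext ω; ring
  have F0 : ∀ᵐ ω ∂Q, m₀ (X ω) - ν₀ (X ω) = 0 := by
    refine aux_overlap Q X hX (fun ω => 1 - A ω) (fun x => 1 - e₁ x) (he₁.1.const_sub 1) δ hδ0
      (hbdQ.mono fun ω h => ⟨by linarith [h.1.2], by linarith [h.1.1]⟩) ?_
      (fun x => m₀ x - ν₀ x) (hm₀.1.sub hν₀) (hQP.ae_le G0)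
    rintro h hh ⟨C, hC⟩
    have a := he₁.2 h hh ⟨C, hC⟩
    simp only [one_mul] at a
    have hhm : AEStronglyMeasurable (fun ω => h (X ω)) Q := (hh.comp hX).aestronglyMeasurable
    have j : Integrable (fun ω => h (X ω)) Q :=
      Integrable.of_bound hhm (C := C) (ae_of_all _ fun ω => hC _)
    have j1 : Integrable (fun ω => A ω * h (X ω)) Q :=
      j.bdd_mul (c := 1) (by fun_prop) (ae_of_all _ hA1)
    have j2 : Integrable (fun ω => e₁ (X ω) * h (X ω)) Q := by
      refine j.bdd_mul (c := 1) (he₁.1.comp hX).aestronglyMeasurable ?_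
      filter_upwards [hbdQ] with ω hω
      rw [Real.norm_eq_abs, abs_le]
      constructor <;> linarith [hω.1.1, hω.1.2]
    simp only [sub_mul, one_mul]
    rw [integral_sub j j1, integral_sub j j2, a]
  -- the propensity of study membership
  have Fπ : ∀ᵐ ω ∂P, (1 : ℝ) * (π (X ω) - ρ (X ω)) = 0 := by
    refine aux_pin P X hX (fun _ => 1) measurable_const (fun _ => Or.inr rfl) π ρ hπ.1 hρ ?_
    rintro h hh ⟨C, hC⟩
    rw [← hπ.2 h hh ⟨C, hC⟩]
    have a := aux_tower hm P (fun ω => h (X ω)) R (hsmX h hh) iR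
      (iR.bdd_mul (c := C) (hh.comp hX).aestronglyMeasurable (ae_of_all _ fun ω => hC _))
    simp only [hρe] at a
    simp only [one_mul, mul_comm _ (h _)]
    exact a
  -- conclusion
  have iD : Integrable (fun ω => m₁ (X ω) - m₀ (X ω)) Q := by
    refine (iν₁.sub iν₀Q).congr ?_
    filter_upwards [F1, F0] with ω h1 h0
    simp only [Pi.sub_apply]
    linarith
  have hfin := aux_tower hm P (fun ω => m₁ (X ω) - m₀ (X ω)) R
    (hsmX (fun x => m₁ x - m₀ x) (hm₁.1.sub hm₀.1)) iR
    ((hIR _ iD).congr (ae_of_all _ fun ω => mul_comm _ _))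
  simp only [hρe] at hfin
  have c1 : ∫ ω, π (X ω) * (m₁ (X ω) - m₀ (X ω)) ∂P =
      ∫ ω, (m₁ (X ω) - m₀ (X ω)) * ρ (X ω) ∂P := by
    apply integral_congr_ae
    filter_upwards [Fπ] with ω h
    have : π (X ω) = ρ (X ω) := by linarith
    simp only [this]
    ring
  rw [c1, ← hfin]
  simp only [mul_comm _ (R _)]
  rw [hint']
  congr 1
  have c2 : ∫ ω, (m₁ (X ω) - m₀ (X ω)) ∂Q = ∫ ω, (ν₁ (X ω) - ν₀ (X ω)) ∂Q := by
    apply integral_congr_ae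
    filter_upwards [F1, F0] with ω h1 h0
    linarith
  have c3 : ∫ ω, ν₁ (X ω) ∂Q = ∫ ω, Y1 ω ∂Q := by
    have : ∫ ω, (Q[Y1|MeasurableSpace.comap X inferInstance]) ω ∂Q = ∫ ω, Y1 ω ∂Q := integral_condExp hm
    simpa only [hν₁e] using this
  have c4 : ∫ ω, ν₀ (X ω) ∂Q = ∫ ω, Y0 ω ∂Q := by
    have := T0 (fun _ => 1) measurable_const ⟨1, fun _ => by simp⟩
    simpa using this.symm
  rw [c2, integral_sub iν₁ iν₀Q, integral_sub hY1Q hY0Q, c3, c4]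
end

section
/- Exchangeability equates the pooled and RCT control-outcome regressions (the identity m₀ = μ₀ used under Assumption 2): assume A ≤ R ℙ-almost surely; Y = Y(0) on the event {A = 0}; under ℙ₁ = ℙ(· ∣ R=1), A is conditionally independent of Y(0) given σ(X); under ℙ, R is conditionally independent of Y(0) given σ(X); and there is δ ∈ (0, 1/2) with e₁(X) ≤ 1 − δ and π(X) ≥ δ ℙ-almost surely, where e₁(X) is a version of ℙ₁(A=1 ∣ σ(X)) and π(X) a version of ℙ(R=1 ∣ σ(X)). Then any version m₀(X) of 𝔼[Y ∣ X, A=0] under ℙ and any version μ₀(X) of 𝔼[Y ∣ X, A=0] under ℙ₁ satisfy m₀(X) = μ₀(X) ℙ-almost surely. -/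
open MeasureTheory ProbabilityTheory

lemma aux_condExp_mul {Ω : Type*} (m : MeasurableSpace Ω) [mΩ : MeasurableSpace Ω] [StandardBorelSpace Ω]
    (Q : Measure Ω) [IsFiniteMeasure Q] (hm : m ≤ mΩ)
    (f g : Ω → ℝ) (hf : Measurable f) (hg : Measurable g)
    (hfi : Integrable f Q) (hgi : Integrable g Q) (hfg : Integrable (fun ω => f ω * g ω) Q)
    (hCI : CondIndepFun m hm f g Q) :
    Q[fun ω => f ω * g ω | m] =ᵐ[Q] fun ω => (Q[f | m]) ω * (Q[g | m]) ω := by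
  have h := (condIndepFun_iff_map_prod_eq_prod_map_map hf hg).1 hCI
  have h' := ae_of_ae_trim hm h
  filter_upwards [h', condExp_ae_eq_integral_condExpKernel hm hfi,
    condExp_ae_eq_integral_condExpKernel hm hgi,
    condExp_ae_eq_integral_condExpKernel hm hfg] with ω h1 h2 h3 h4
  rw [h2, h3, h4]
  have hI : IndepFun f g (condExpKernel Q m ω) := by
    rw [indepFun_iff_map_prod_eq_prod_map_map hf.aemeasurable hg.aemeasurable]
    rw [Kernel.map_apply _ (hf.prodMk hg), Kernel.prod_apply, Kernel.map_apply _ hf,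
      Kernel.map_apply _ hg] at h1
    exact h1
  exact hI.integral_fun_mul_eq_mul_integral hf.aestronglyMeasurable hg.aestronglyMeasurable

lemma aux_L1 {Ω : Type*} (m : MeasurableSpace Ω) [mΩ : MeasurableSpace Ω] [StandardBorelSpace Ω]
    (Q : Measure Ω) [IsFiniteMeasure Q] (hm : m ≤ mΩ)
    (f g : Ω → ℝ) (hf : Measurable f) (hg : Measurable g) (hfb : ∀ ω, |f ω| ≤ 1)
    (hgi : Integrable g Q) (hCI : CondIndepFun m hm f g Q)
    (h : Ω → ℝ) (hh : StronglyMeasurable[m] h) (C : ℝ) (hC : ∀ ω, |h ω| ≤ C) :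
    ∫ ω, f ω * g ω * h ω ∂Q = ∫ ω, f ω * (Q[g | m]) ω * h ω ∂Q := by
  have hfi : Integrable f Q := Integrable.of_bound hf.aestronglyMeasurable 1
    (ae_of_all _ hfb)
  have hfg : Integrable (fun ω => f ω * g ω) Q :=
    hgi.bdd_mul hf.aestronglyMeasurable (ae_of_all _ hfb)
  have hG : Integrable (Q[g | m]) Q := integrable_condExp
  have hfG : Integrable (fun ω => f ω * (Q[g | m]) ω) Q :=
    hG.bdd_mul hf.aestronglyMeasurable (ae_of_all _ hfb)
  have hh' : AEStronglyMeasurable h Q := (hh.mono hm).aestronglyMeasurable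
  have i1 : Integrable ((fun ω => f ω * g ω) * h) Q := hfg.mul_bdd hh' (ae_of_all _ hC)
  have i2 : Integrable ((fun ω => f ω * (Q[g | m]) ω) * h) Q :=
    hfG.mul_bdd hh' (ae_of_all _ hC)
  have e1 := condExp_mul_of_stronglyMeasurable_right hh i1 hfg
  have e2 := condExp_mul_of_stronglyMeasurable_right hh i2 hfG
  have e3 : Q[fun ω => f ω * (Q[g | m]) ω | m] =ᵐ[Q] Q[f | m] * Q[g | m] :=
    condExp_mul_of_stronglyMeasurable_right stronglyMeasurable_condExp hfG hfi
  have e4 := aux_condExp_mul m Q hm f g hf hg hfi hgi hfg hCI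
  change ∫ ω, ((fun ω => f ω * g ω) * h) ω ∂Q = ∫ ω, ((fun ω => f ω * (Q[g | m]) ω) * h) ω ∂Q
  rw [← integral_condExp hm (f := (fun ω => f ω * g ω) * h),
    ← integral_condExp hm (f := (fun ω => f ω * (Q[g | m]) ω) * h)]
  apply integral_congr_ae
  filter_upwards [e1, e2, e3, e4] with ω h1 h2 h3 h4
  rw [h1, h2]
  simp only [Pi.mul_apply] at *
  rw [h3, h4]

lemma aux_uniq {Ω : Type*} [mΩ : MeasurableSpace Ω] {p : ℕ}
    (Q : Measure Ω) [IsFiniteMeasure Q] (X : Ω → Fin p → ℝ) (hX : Measurable X)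
    (ind W G : Ω → ℝ) (hi : Measurable ind) (hi0 : ∀ ω, 0 ≤ ind ω) (hi1 : ∀ ω, ind ω ≤ 1)
    (v : (Fin p → ℝ) → ℝ) (hv : IsCondVersion Q X ind W v)
    (hGm : StronglyMeasurable[MeasurableSpace.comap X inferInstance] G) (hG : Integrable G Q)
    (hGW : ∀ h : (Fin p → ℝ) → ℝ, Measurable h → (∃ C, ∀ x, |h x| ≤ C) →
      ∫ ω, ind ω * W ω * h (X ω) ∂Q = ∫ ω, ind ω * G ω * h (X ω) ∂Q) :
    ∀ᵐ ω ∂Q, ind ω = 0 ∨ v (X ω) = G ω := by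
  obtain ⟨g, hg, rfl⟩ := hGm.measurable.exists_eq_measurable_comp
  obtain ⟨hvm, hv⟩ := hv
  have hib : ∀ ω, ‖ind ω‖ ≤ 1 := fun ω => by
    rw [Real.norm_eq_abs, abs_of_nonneg (hi0 ω)]; exact hi1 ω
  have key : ∀ n : ℕ, ∀ᵐ ω ∂Q, |v (X ω)| ≤ n → (ind ω = 0 ∨ v (X ω) = g (X ω)) := by
    intro n
    let h : (Fin p → ℝ) → ℝ := fun x =>
      if |v x| ≤ n then (if g x ≤ v x then 1 else -1) else 0
    have hh : Measurable h := by
      refine Measurable.ite (measurableSet_le (by fun_prop) (by fun_prop)) ?_ (by fun_prop)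
      exact Measurable.ite (measurableSet_le hg hvm) (by fun_prop) (by fun_prop)
    have hb : ∀ x, |h x| ≤ 1 := by
      intro x; simp only [h]; split_ifs <;> simp
    have hhX : AEStronglyMeasurable (fun ω => h (X ω)) Q :=
      (hh.comp hX).aestronglyMeasurable
    have e := (hv h hh ⟨1, hb⟩).symm.trans (hGW h hh ⟨1, hb⟩)
    have iG : Integrable (fun ω => ind ω * g (X ω) * h (X ω)) Q :=
      (hG.bdd_mul hi.aestronglyMeasurable (ae_of_all _ hib)).mul_bdd hhX
        (ae_of_all _ fun ω => hb _)
    have iV : Integrable (fun ω => ind ω * v (X ω) * h (X ω)) Q := by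
      refine Integrable.of_bound
        ((hi.mul (hvm.comp hX)).mul (hh.comp hX)).aestronglyMeasurable (n : ℝ)
        (ae_of_all _ fun ω => ?_)
      have h1 := hib ω
      have h2 : ‖v (X ω) * h (X ω)‖ ≤ n := by
        simp only [h, Real.norm_eq_abs, abs_mul]
        split_ifs with a b <;> simp [a]
      rw [mul_assoc, norm_mul]
      calc _ ≤ 1 * (n : ℝ) := mul_le_mul h1 h2 (norm_nonneg _) zero_le_one
        _ = n := one_mul _
    have nn : ∀ ω, 0 ≤ ind ω * v (X ω) * h (X ω) - ind ω * g (X ω) * h (X ω) := by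
      intro ω
      have : ind ω * v (X ω) * h (X ω) - ind ω * g (X ω) * h (X ω)
        = ind ω * ((v (X ω) - g (X ω)) * h (X ω)) := by ring
      rw [this]
      refine mul_nonneg (hi0 ω) ?_
      simp only [h]
      split_ifs with a b <;> linarith
    have z : ∫ ω, (ind ω * v (X ω) * h (X ω) - ind ω * g (X ω) * h (X ω)) ∂Q = 0 := by
      rw [integral_sub iV iG, e]; exact sub_self _
    have z' := (integral_eq_zero_iff_of_nonneg nn (iV.sub iG)).1 z
    filter_upwards [z'] with ω hω hn
    have : ind ω * ((v (X ω) - g (X ω)) * h (X ω)) = 0 := by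
      rw [← (show _ = (0 : ℝ) from hω)]; ring
    rcases mul_eq_zero.1 this with h0 | h0
    · exact Or.inl h0
    · right
      simp only [h, hn, if_true] at h0
      split_ifs at h0 <;> linarith
  filter_upwards [ae_all_iff.2 key] with ω hω
  obtain ⟨n, hn⟩ := exists_nat_ge |v (X ω)|
  exact hω n hn

lemma aux_condprob {Ω : Type*} [mΩ : MeasurableSpace Ω] {p : ℕ}
    (Q : Measure Ω) [IsFiniteMeasure Q] (X : Ω → Fin p → ℝ) (hX : Measurable X)
    (W : Ω → ℝ) (hW : Integrable W Q)
    (v : (Fin p → ℝ) → ℝ) (hv : IsCondVersion Q X (fun _ => 1) W v) :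
    ∀ᵐ ω ∂Q, v (X ω) = (Q[W | MeasurableSpace.comap X inferInstance]) ω := by
  have := aux_uniq Q X hX (fun _ => 1) W (Q[W | MeasurableSpace.comap X inferInstance])
    measurable_const (by simp) (by simp) v hv stronglyMeasurable_condExp integrable_condExp ?_
  · simpa using this
  · rintro h hh ⟨C, hC⟩
    simp only [one_mul]
    have hm : StronglyMeasurable[MeasurableSpace.comap X inferInstance] (fun ω => h (X ω)) :=
      (hh.comp (comap_measurable X)).stronglyMeasurable
    have i1 : Integrable (W * fun ω => h (X ω)) Q :=
      hW.mul_bdd (hh.comp hX).aestronglyMeasurable (ae_of_all _ fun ω => hC _)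
    have e := condExp_mul_of_stronglyMeasurable_right hm i1 hW
    have e' := integral_congr_ae e
    rw [integral_condExp hX.comap_le] at e'
    exact e'

lemma aux_null {Ω : Type*} (m : MeasurableSpace Ω) [mΩ : MeasurableSpace Ω]
    (Q : Measure Ω) [IsFiniteMeasure Q] (hm : m ≤ mΩ)
    (W : Ω → ℝ) (hW : Integrable W Q) (T : Set Ω) (hT : MeasurableSet[m] T)
    (h0 : ∀ᵐ ω ∂Q, ω ∈ T → W ω = 0) (hpos : ∀ᵐ ω ∂Q, 0 < (Q[W | m]) ω) : Q T = 0 := by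
  have e := setIntegral_condExp hm hW hT
  have e0 : ∫ ω in T, W ω ∂Q = 0 := by
    rw [setIntegral_congr_ae (g := fun _ => (0 : ℝ)) (hm _ hT) h0]; simp
  rw [e0, setIntegral_eq_zero_iff_of_nonneg_ae
    (ae_restrict_of_ae (hpos.mono fun ω h => h.le)) integrable_condExp.integrableOn] at e
  have e' := (ae_restrict_iff' (hm _ hT)).1 e
  rw [measure_eq_zero_iff_ae_notMem]
  filter_upwards [e', hpos] with ω h1 h2 h3
  exact h2.ne' (h1 h3)

lemma aux_intcond {Ω : Type*} [mΩ : MeasurableSpace Ω] (P : Measure Ω)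
    (R : Ω → ℝ) (hR : Measurable R) (hR01 : ∀ ω, R ω = 0 ∨ R ω = 1) (f : Ω → ℝ) :
    ∫ ω, f ω ∂(P[|{ω | R ω = 1}]) = (P {ω | R ω = 1}).toReal⁻¹ * ∫ ω, R ω * f ω ∂P := by
  have hs : MeasurableSet {ω | R ω = 1} := hR (measurableSet_singleton 1)
  rw [ProbabilityTheory.cond, integral_smul_measure, ENNReal.toReal_inv, smul_eq_mul,
    ← integral_indicator hs]
  congr 2
  ext ω
  rcases hR01 ω with h | h <;> simp [Set.indicator, h]

/-- Exchangeability equates the pooled and RCT control-outcome regressions: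
`m₀(X) = μ₀(X)` P-almost surely. -/
theorem pooled_eq_rct_control_regression {Ω : Type*} [MeasurableSpace Ω] [StandardBorelSpace Ω]
    [Nonempty Ω]
    (P : Measure Ω) [IsProbabilityMeasure P]
    (p : ℕ) (hp : 1 ≤ p)
    (X : Ω → Fin p → ℝ) (hX : Measurable X)
    (A R : Ω → ℝ) (hA : Measurable A) (hR : Measurable R)
    (hA01 : ∀ ω, A ω = 0 ∨ A ω = 1) (hR01 : ∀ ω, R ω = 0 ∨ R ω = 1)
    -- external-control units are never treated
    (hAR : ∀ᵐ ω ∂P, A ω ≤ R ω)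
    (Y0 Y1 : Ω → ℝ) (hY0m : Measurable Y0) (hY1m : Measurable Y1)
    (hY0 : Integrable Y0 P) (hY1 : Integrable Y1 P)
    (Y : Ω → ℝ) (hY : ∀ ω, Y ω = A ω * Y1 ω + (1 - A ω) * Y0 ω)
    (q : ℝ) (hq : P {ω | R ω = 1} = ENNReal.ofReal q) (hq0 : 0 < q) (hq1 : q < 1)
    -- Y = Y(0) on the event {A = 0}
    (hYA0 : ∀ ω, A ω = 0 → Y ω = Y0 ω)
    -- A ⫫ Y(0) ∣ σ(X) under P₁ = P(⬝ ∣ R = 1)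
    (hCI : CondIndepFun (MeasurableSpace.comap X inferInstance) hX.comap_le
      A Y0 (P[|{ω | R ω = 1}]))
    -- exchangeability: R ⫫ Y(0) ∣ σ(X) under P
    (hExch : CondIndepFun (MeasurableSpace.comap X inferInstance) hX.comap_le R Y0 P)
    -- overlap: e₁(X) ≤ 1 − δ and π(X) ≥ δ, P-a.s.
    (δ : ℝ) (hδ : δ ∈ Set.Ioo (0 : ℝ) (1 / 2))
    (e₁ : (Fin p → ℝ) → ℝ)
    (he₁ : IsCondVersion (P[|{ω | R ω = 1}]) X (fun _ => 1) A e₁)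
    (π : (Fin p → ℝ) → ℝ) (hπ : IsCondVersion P X (fun _ => 1) R π)
    (hbd : ∀ᵐ ω ∂P, e₁ (X ω) ≤ 1 - δ ∧ δ ≤ π (X ω))
    -- m₀ under P and μ₀ under P₁
    (m₀ : (Fin p → ℝ) → ℝ) (hm₀ : IsCondVersion P X (fun ω => 1 - A ω) Y m₀)
    (μ₀ : (Fin p → ℝ) → ℝ)
    (hμ₀ : IsCondVersion (P[|{ω | R ω = 1}]) X (fun ω => 1 - A ω) Y μ₀) :
    ∀ᵐ ω ∂P, m₀ (X ω) = μ₀ (X ω) := by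
  have hm := hX.comap_le
  set P1 := P[|{ω | R ω = 1}] with hP1
  have hs : MeasurableSet {ω | R ω = 1} := hR (measurableSet_singleton 1)
  have hs0 : P {ω | R ω = 1} ≠ 0 := by rw [hq]; simpa using hq0
  have hqr : (P {ω | R ω = 1}).toReal = q := by rw [hq, ENNReal.toReal_ofReal hq0.le]
  have hac : P1 ≪ P := cond_absolutelyContinuous
  have hic : ∀ f : Ω → ℝ, ∫ ω, R ω * f ω ∂P = q * ∫ ω, f ω ∂P1 := by
    intro f
    rw [hP1, aux_intcond P R hR hR01, hqr, mul_inv_cancel_left₀ hq0.ne']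
  have hint : ∀ f : Ω → ℝ, Integrable f P → Integrable f P1 := fun f hf =>
    (hf.restrict (s := {ω | R ω = 1})).smul_measure (ENNReal.inv_ne_top.2 hs0)
  have hAi : Integrable A P := Integrable.of_bound hA.aestronglyMeasurable 1
    (ae_of_all _ fun ω => by rcases hA01 ω with h | h <;> simp [h])
  have hRi : Integrable R P := Integrable.of_bound hR.aestronglyMeasurable 1
    (ae_of_all _ fun ω => by rcases hR01 ω with h | h <;> simp [h])
  have hA' : ∀ ω, |1 - A ω| ≤ 1 := fun ω => by rcases hA01 ω with h | h <;> simp [h]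
  have hR' : ∀ ω, |1 - R ω| ≤ 1 := fun ω => by rcases hR01 ω with h | h <;> simp [h]
  have hRb : ∀ ω, |R ω| ≤ 1 := fun ω => by rcases hR01 ω with h | h <;> simp [h]
  have hYY : ∀ ω, (1 - A ω) * Y ω = (1 - A ω) * Y0 ω := fun ω => by
    rcases hA01 ω with h | h
    · rw [hYA0 ω h]
    · simp [h]
  set G : Ω → ℝ := P[Y0 | (MeasurableSpace.comap X MeasurableSpace.pi)] with hGdef
  have hGm : StronglyMeasurable[(MeasurableSpace.comap X MeasurableSpace.pi)] G := stronglyMeasurable_condExp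
  have hGi : Integrable G P := integrable_condExp
  -- conditional expectations of `Y0` agree
  have hG1 : G =ᵐ[P1] P1[Y0 | (MeasurableSpace.comap X MeasurableSpace.pi)] := by
    refine ae_eq_condExp_of_forall_setIntegral_eq hm (hint _ hY0)
      (fun s _ _ => (hint _ hGi).integrableOn) (fun s hms _ => ?_) hGm.aestronglyMeasurable
    have hind : StronglyMeasurable[(MeasurableSpace.comap X MeasurableSpace.pi)] (s.indicator (fun _ => (1 : ℝ))) :=
      stronglyMeasurable_const.indicator hms
    have e := aux_L1 (MeasurableSpace.comap X MeasurableSpace.pi) P hm R Y0 hR hY0m hRb hY0 hExch (s.indicator (fun _ => (1 : ℝ))) hind 1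
      (fun ω => by by_cases h : ω ∈ s <;> simp [h])
    simp only [mul_assoc] at e
    rw [hic, hic] at e
    have e' := mul_left_cancel₀ hq0.ne' e
    rw [← integral_indicator (hm _ hms), ← integral_indicator (hm _ hms)]
    have t : ∀ f : Ω → ℝ, s.indicator f = fun ω => f ω * s.indicator (fun _ => (1 : ℝ)) ω := by
      intro f; ext ω; by_cases h : ω ∈ s <;> simp [h]
    rw [t G, t Y0]
    exact e'.symm
  have hCI' : CondIndepFun (MeasurableSpace.comap X MeasurableSpace.pi) hm (fun ω => 1 - A ω) Y0 P1 :=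
    hCI.comp (φ := fun x => 1 - x) (ψ := id) (by fun_prop) measurable_id
  have hEx' : CondIndepFun (MeasurableSpace.comap X MeasurableSpace.pi) hm (fun ω => 1 - R ω) Y0 P :=
    hExch.comp (φ := fun x => 1 - x) (ψ := id) (by fun_prop) measurable_id
  have hX1 : ∀ h : (Fin p → ℝ) → ℝ, Measurable h → (∃ C, ∀ x, |h x| ≤ C) →
      ∫ ω, (1 - A ω) * Y ω * h (X ω) ∂P1 = ∫ ω, (1 - A ω) * G ω * h (X ω) ∂P1 := by
    rintro h hh ⟨C, hC⟩
    simp only [hYY]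
    rw [aux_L1 (MeasurableSpace.comap X MeasurableSpace.pi) P1 hm (fun ω => 1 - A ω) Y0 (by fun_prop) hY0m hA' (hint _ hY0) hCI'
      (fun ω => h (X ω)) (hh.comp (comap_measurable X)).stronglyMeasurable C (fun ω => hC _)]
    apply integral_congr_ae
    filter_upwards [hG1] with ω hω
    rw [hω]
  have hX0 : ∀ h : (Fin p → ℝ) → ℝ, Measurable h → (∃ C, ∀ x, |h x| ≤ C) →
      ∫ ω, (1 - A ω) * Y ω * h (X ω) ∂P = ∫ ω, (1 - A ω) * G ω * h (X ω) ∂P := by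
    rintro h hh ⟨C, hC⟩
    have e1 := hX1 h hh ⟨C, hC⟩
    simp only [hYY] at e1 ⊢
    have e2 := aux_L1 (MeasurableSpace.comap X MeasurableSpace.pi) P hm (fun ω => 1 - R ω) Y0 (by fun_prop) hY0m hR' hY0 hEx'
      (fun ω => h (X ω)) (hh.comp (comap_measurable X)).stronglyMeasurable C (fun ω => hC _)
    have dec : ∀ Z : Ω → ℝ, Integrable Z P → ∫ ω, (1 - A ω) * Z ω * h (X ω) ∂P =
        q * ∫ ω, (1 - A ω) * Z ω * h (X ω) ∂P1 + ∫ ω, (1 - R ω) * Z ω * h (X ω) ∂P := by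
      intro Z hZ
      have hhX : AEStronglyMeasurable (fun ω => h (X ω)) P := (hh.comp hX).aestronglyMeasurable
      have j1 : Integrable (fun ω => (1 - A ω) * Z ω * h (X ω)) P :=
        (hZ.bdd_mul (by fun_prop) (ae_of_all _ hA')).mul_bdd hhX (ae_of_all _ fun ω => hC _)
      have j2 : Integrable (fun ω => R ω * ((1 - A ω) * Z ω * h (X ω))) P :=
        j1.bdd_mul hR.aestronglyMeasurable (ae_of_all _ hRb)
      have j3 : Integrable (fun ω => (1 - R ω) * Z ω * h (X ω)) P :=
        (hZ.bdd_mul (by fun_prop) (ae_of_all _ hR')).mul_bdd hhX (ae_of_all _ fun ω => hC _)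
      rw [← hic, ← integral_add j2 j3]
      apply integral_congr_ae
      filter_upwards [hAR] with ω hω
      rcases hA01 ω with a | a <;> rcases hR01 ω with r | r <;> simp only [a, r] at hω ⊢
      · ring
      · ring
      · norm_num at hω
      · ring
    rw [dec _ hY0, dec _ hGi, e1, e2]
  have hi0 : ∀ ω, 0 ≤ 1 - A ω := fun ω => by rcases hA01 ω with h | h <;> simp [h]
  have hi1 : ∀ ω, 1 - A ω ≤ 1 := fun ω => by rcases hA01 ω with h | h <;> simp [h]
  have u0 := aux_uniq P X hX (fun ω => 1 - A ω) Y G (by fun_prop) hi0 hi1 m₀ hm₀ hGm hGi hX0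
  have u1 := aux_uniq P1 X hX (fun ω => 1 - A ω) Y G (by fun_prop) hi0 hi1 μ₀ hμ₀ hGm
    (hint _ hGi) hX1
  have hT : MeasurableSet[(MeasurableSpace.comap X MeasurableSpace.pi)] {ω | m₀ (X ω) ≠ μ₀ (X ω)} :=
    ⟨{x | m₀ x ≠ μ₀ x}, (measurableSet_eq_fun hm₀.1 hμ₀.1).compl, rfl⟩
  have n1 : P1 {ω | m₀ (X ω) ≠ μ₀ (X ω)} = 0 := by
    refine aux_null (MeasurableSpace.comap X MeasurableSpace.pi) P1 hm (fun ω => 1 - A ω) ((integrable_const 1).sub (hint _ hAi)) _ hT ?_ ?_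
    · filter_upwards [hac.ae_le u0, u1] with ω a b hne
      rcases a with a | a
      · exact a
      rcases b with b | b
      · exact b
      exact absurd (a.trans b.symm) hne
    · have c := condExp_sub (integrable_const (1 : ℝ)) (hint _ hAi) (MeasurableSpace.comap X MeasurableSpace.pi)
      filter_upwards [c, hac.ae_le hbd, aux_condprob P1 X hX A (hint _ hAi) e₁ he₁]
        with ω c1 c2 c3
      have c4 : (P1[fun ω => 1 - A ω | (MeasurableSpace.comap X MeasurableSpace.pi)]) ω = 1 - e₁ (X ω) := by
        rw [c3]; refine Eq.trans c1 ?_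
        rw [Pi.sub_apply, condExp_const hm]
      rw [c4]
      linarith [c2.1, hδ.1]
  have n0 : P {ω | m₀ (X ω) ≠ μ₀ (X ω)} = 0 := by
    refine aux_null (MeasurableSpace.comap X MeasurableSpace.pi) P hm R hRi _ hT ?_ ?_
    · have c : P ({ω | R ω = 1} ∩ {ω | m₀ (X ω) ≠ μ₀ (X ω)}) = 0 := by
        rw [hP1, cond_apply hs] at n1
        rcases mul_eq_zero.1 n1 with h | h
        · exact absurd h (ENNReal.inv_ne_zero.2 (measure_ne_top _ _))
        · exact h
      rw [measure_eq_zero_iff_ae_notMem] at c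
      filter_upwards [c] with ω h1 h2
      rcases hR01 ω with h | h
      · exact h
      · exact absurd ⟨h, h2⟩ h1
    · filter_upwards [hbd, aux_condprob P X hX R hRi π hπ] with ω c2 c3
      rw [← c3]
      linarith [c2.2, hδ.1]
  exact n0
end

section
/- Mixed representation of the ATE used in the proof of Theorem 1: assume A ≤ R ℙ-almost surely; under ℙ₁ = ℙ(· ∣ R=1), A is conditionally independent of (Y(0), Y(1)) given σ(X); and there is δ ∈ (0, 1/2) with δ ≤ e₁(X) ≤ 1 − δ and π(X) ≥ δ ℙ-almost surely, where e₁(X) is a version of ℙ₁(A=1 ∣ σ(X)) and π(X) a version of ℙ(R=1 ∣ σ(X)). Let m₁(X) be a version of 𝔼[Y ∣ X, A=1] under ℙ and μ₀(X) a version of 𝔼[Y ∣ X, A=0] under ℙ₁. Then 𝔼[Y(1) − Y(0) ∣ R=1] = 𝔼[ (R/q)·( m₁(X) − μ₀(X) ) ]. -/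
open MeasureTheory ProbabilityTheory

/-- Conditional independence factorizes conditional expectations of products. -/
lemma condExp_mul_of_condIndepFun {Ω : Type*} {m mΩ : MeasurableSpace Ω} [StandardBorelSpace Ω]
    (hm : m ≤ mΩ) (Q : Measure Ω) [IsFiniteMeasure Q] (B Z : Ω → ℝ)
    (hB : Measurable B) (hZ : Measurable Z) (hBi : Integrable B Q) (hZi : Integrable Z Q)
    (hBZ : Integrable (fun ω => B ω * Z ω) Q)
    (hCI : CondIndepFun m hm B Z Q) :
    Q[fun ω => B ω * Z ω | m] =ᵐ[Q] fun ω => (Q[B | m]) ω * (Q[Z | m]) ω := by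
  have h1 := (condIndepFun_iff_map_prod_eq_prod_map_map hB hZ).1 hCI
  have h2 := ae_eq_of_ae_eq_trim h1
  filter_upwards [h2, condExp_ae_eq_integral_condExpKernel hm hBZ,
    condExp_ae_eq_integral_condExpKernel hm hBi,
    condExp_ae_eq_integral_condExpKernel hm hZi] with ω hω e1 e2 e3
  rw [e1, e2, e3]
  rcases isEmpty_or_nonempty Ω with h | h
  · exact (h.false ω).elim
  have hind : IndepFun B Z (condExpKernel Q m ω) := by
    rw [indepFun_iff_map_prod_eq_prod_map_map hB.aemeasurable hZ.aemeasurable]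
    rw [Kernel.map_apply _ (hB.prodMk hZ), Kernel.prod_apply, Kernel.map_apply _ hB,
      Kernel.map_apply _ hZ] at hω
    exact hω
  exact hind.integral_fun_mul_eq_mul_integral hB.aestronglyMeasurable hZ.aestronglyMeasurable

lemma version_eq_condExp {Ω : Type*} [mΩ : MeasurableSpace Ω] [StandardBorelSpace Ω]
    (Q : Measure Ω) [IsFiniteMeasure Q] {p : ℕ}
    (X : Ω → Fin p → ℝ) (hX : Measurable X) (B Z : Ω → ℝ)
    (hB : Measurable B) (hZ : Measurable Z) (hB01 : ∀ ω, B ω = 0 ∨ B ω = 1)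
    (hZi : Integrable Z Q)
    (hCI : CondIndepFun (MeasurableSpace.comap X inferInstance) hX.comap_le B Z Q)
    (c : (Fin p → ℝ) → ℝ) (hc : IsCondVersion Q X (fun _ => 1) B c)
    (δ : ℝ) (hδ : 0 < δ) (hcb : ∀ᵐ ω ∂Q, δ ≤ c (X ω) ∧ c (X ω) ≤ 1)
    (v : (Fin p → ℝ) → ℝ) (hv : IsCondVersion Q X B Z v) :
    (fun ω => v (X ω)) =ᵐ[Q] Q[Z | MeasurableSpace.comap X inferInstance] := by
  have hm := hX.comap_le
  set m : MeasurableSpace Ω := MeasurableSpace.comap X inferInstance with hmdef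
  have hXm : Measurable[m] X := comap_measurable X
  have hcomp : ∀ f : (Fin p → ℝ) → ℝ, Measurable f → StronglyMeasurable[m] (fun ω => f (X ω)) :=
    fun f hf => (hf.comp hXm).stronglyMeasurable
  have hBb : ∀ ω, ‖B ω‖ ≤ 1 := by
    intro ω; rcases hB01 ω with h | h <;> simp [h]
  have hBi : Integrable B Q :=
    Integrable.of_bound hB.aestronglyMeasurable 1 (Filter.Eventually.of_forall hBb)
  have hBZ : Integrable (fun ω => B ω * Z ω) Q :=
    hZi.bdd_mul hB.aestronglyMeasurable (Filter.Eventually.of_forall hBb)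
  have hprod := condExp_mul_of_condIndepFun hm Q B Z hB hZ hBi hZi hBZ hCI
  have hci : Integrable (fun ω => c (X ω)) Q := by
    refine Integrable.of_bound (hc.1.comp hX).aestronglyMeasurable 1 ?_
    filter_upwards [hcb] with ω h
    rw [Real.norm_eq_abs, abs_le]; constructor <;> linarith [h.1, h.2]
  have indb : ∀ T : Set (Fin p → ℝ), ∃ C, ∀ x, |T.indicator (fun _ => (1:ℝ)) x| ≤ C := by
    intro T
    refine ⟨1, fun x => ?_⟩
    by_cases hx : x ∈ T <;> simp [hx]
  have setint : ∀ (T : Set (Fin p → ℝ)), MeasurableSet T → ∀ f : Ω → ℝ,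
      ∫ ω in X ⁻¹' T, f ω ∂Q = ∫ ω, f ω * T.indicator (fun _ => (1:ℝ)) (X ω) ∂Q := by
    intro T hT f
    rw [← integral_indicator (hX hT)]
    congr 1; ext ω
    by_cases hx : X ω ∈ T <;> simp [hx, Set.indicator]
  have hcE : (fun ω => c (X ω)) =ᵐ[Q] Q[B | m] := by
    refine ae_eq_condExp_of_forall_setIntegral_eq hm hBi (fun _ _ _ => hci.integrableOn) ?_
      (hcomp c hc.1).aestronglyMeasurable
    rintro s ⟨T, hT, rfl⟩ -
    rw [setint T hT, setint T hT]
    have := hc.2 _ (measurable_const.indicator hT) (indb T)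
    simpa using this.symm
  have main : ∀ n : ℕ, ∀ᵐ ω ∂Q, |v (X ω)| ≤ n → v (X ω) = (Q[Z | m]) ω := by
    intro n
    let S : Set (Fin p → ℝ) := {x | |v x| ≤ n}
    have hS : MeasurableSet S := measurableSet_le (by have := hv.1; fun_prop) measurable_const
    let I : (Fin p → ℝ) → ℝ := S.indicator (fun _ => 1)
    have hI : Measurable I := measurable_const.indicator hS
    have hIb : ∀ x, ‖I x‖ ≤ 1 := by
      intro x; by_cases hx : x ∈ S <;> simp [I, hx]
    have hvI : Measurable (fun x => v x * I x) := hv.1.mul hI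
    have hvIb : ∀ x, ‖v x * I x‖ ≤ n := by
      intro x
      by_cases hx : x ∈ S
      · have hx' : |v x| ≤ n := hx
        simpa [I, hx] using hx'
      · simp [I, hx]
    have hL : Integrable ((fun ω => I (X ω)) * (fun ω => B ω * Z ω)) Q :=
      hBZ.bdd_mul (hI.comp hX).aestronglyMeasurable (Filter.Eventually.of_forall fun ω => hIb _)
    have hR : Integrable ((fun ω => v (X ω) * I (X ω)) * B) Q :=
      hBi.bdd_mul (hvI.comp hX).aestronglyMeasurable (Filter.Eventually.of_forall fun ω => hvIb _)
    have e1 := condExp_mul_of_stronglyMeasurable_left (hcomp I hI) hL hBZ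
    have e2 := condExp_mul_of_stronglyMeasurable_left (hcomp _ hvI) hR hBi
    have e3 : Q[(fun ω => v (X ω) * I (X ω)) * B | m] =ᵐ[Q]
        Q[(fun ω => I (X ω)) * (fun ω => B ω * Z ω) | m] := by
      refine ae_eq_condExp_of_forall_setIntegral_eq hm hL
        (fun _ _ _ => integrable_condExp.integrableOn) ?_
        stronglyMeasurable_condExp.aestronglyMeasurable
      rintro s ⟨T, hT, rfl⟩ -
      rw [setIntegral_condExp hm hR ⟨T, hT, rfl⟩, setint T hT, setint T hT]
      have := hv.2 _ (measurable_const.indicator (hS.inter hT)) (indb (S ∩ T))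
      have key : ∀ x, (S ∩ T).indicator (fun _ => (1:ℝ)) x
          = I x * T.indicator (fun _ => (1:ℝ)) x := by
        intro x
        by_cases h1 : x ∈ S <;> by_cases h2 : x ∈ T <;> simp [I, h1, h2]
      simp only [key] at this
      calc _ = ∫ ω, B ω * v (X ω) * (I (X ω) * T.indicator (fun _ => (1:ℝ)) (X ω)) ∂Q := by
            congr 1; ext ω; simp only [Pi.mul_apply]; ring
        _ = ∫ ω, B ω * Z ω * (I (X ω) * T.indicator (fun _ => (1:ℝ)) (X ω)) ∂Q := this.symm
        _ = _ := by
            congr 1; ext ω; simp only [Pi.mul_apply]; ring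
    filter_upwards [e1, e2, e3, hcE, hcb, hprod] with ω h1 h2 h3 h4 h5 h6 hle
    rw [h1, h2] at h3
    simp only [Pi.mul_apply] at h3
    rw [h6, ← h4] at h3
    have hI1 : I (X ω) = 1 := by
      have : X ω ∈ S := hle
      simp [I, this]
    rw [hI1] at h3
    have hne : c (X ω) ≠ 0 := by linarith [h5.1] |> fun h : 0 < c (X ω) => h.ne'
    apply mul_right_cancel₀ hne
    linarith
  filter_upwards [ae_all_iff.2 main] with ω h
  obtain ⟨n, hn⟩ := exists_nat_ge |v (X ω)|
  exact h n hn

lemma integral_cond_R {Ω : Type*} [MeasurableSpace Ω] (P : Measure Ω)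
    (R : Ω → ℝ) (hR : Measurable R) (hR01 : ∀ ω, R ω = 0 ∨ R ω = 1)
    (q : ℝ) (hq : P {ω | R ω = 1} = ENNReal.ofReal q) (hq0 : 0 < q) (f : Ω → ℝ) :
    ∫ ω, f ω ∂(P[|{ω | R ω = 1}]) = ∫ ω, R ω / q * f ω ∂P := by
  have hs : MeasurableSet {ω | R ω = 1} := hR (measurableSet_singleton 1)
  rw [ProbabilityTheory.cond, integral_smul_measure, hq, ← integral_indicator hs,
    ENNReal.toReal_inv, ENNReal.toReal_ofReal hq0.le, smul_eq_mul, ← integral_const_mul]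
  congr 1; ext ω
  rcases hR01 ω with h | h
  · simp [Set.indicator, h]
  · simp [Set.indicator, h]

/-- Mixed representation of the ATE used in the proof of Theorem 1:
`𝔼[Y(1) − Y(0) ∣ R=1] = 𝔼[(R/q)·(m₁(X) − μ₀(X))]`. -/
theorem ate_mixed_representation {Ω : Type*} [MeasurableSpace Ω] [StandardBorelSpace Ω]
    [Nonempty Ω]
    (P : Measure Ω) [IsProbabilityMeasure P]
    (p : ℕ) (hp : 1 ≤ p)
    (X : Ω → Fin p → ℝ) (hX : Measurable X)
    (A R : Ω → ℝ) (hA : Measurable A) (hR : Measurable R)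
    (hA01 : ∀ ω, A ω = 0 ∨ A ω = 1) (hR01 : ∀ ω, R ω = 0 ∨ R ω = 1)
    -- external-control units are never treated
    (hAR : ∀ᵐ ω ∂P, A ω ≤ R ω)
    (Y0 Y1 : Ω → ℝ) (hY0m : Measurable Y0) (hY1m : Measurable Y1)
    (hY0 : Integrable Y0 P) (hY1 : Integrable Y1 P)
    (Y : Ω → ℝ) (hY : ∀ ω, Y ω = A ω * Y1 ω + (1 - A ω) * Y0 ω)
    (q : ℝ) (hq : P {ω | R ω = 1} = ENNReal.ofReal q) (hq0 : 0 < q) (hq1 : q < 1)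
    -- strong ignorability: A ⫫ (Y(0), Y(1)) ∣ σ(X) under P₁ = P(⬝ ∣ R = 1)
    (hCI : CondIndepFun (MeasurableSpace.comap X inferInstance) hX.comap_le
      A (fun ω => (Y0 ω, Y1 ω)) (P[|{ω | R ω = 1}]))
    -- overlap: δ ≤ e₁(X) ≤ 1 − δ and π(X) ≥ δ, P-a.s.
    (δ : ℝ) (hδ : δ ∈ Set.Ioo (0 : ℝ) (1 / 2))
    (e₁ : (Fin p → ℝ) → ℝ)
    (he₁ : IsCondVersion (P[|{ω | R ω = 1}]) X (fun _ => 1) A e₁)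
    (π : (Fin p → ℝ) → ℝ) (hπ : IsCondVersion P X (fun _ => 1) R π)
    (hbd : ∀ᵐ ω ∂P, (δ ≤ e₁ (X ω) ∧ e₁ (X ω) ≤ 1 - δ) ∧ δ ≤ π (X ω))
    -- m₁ under P and μ₀ under P₁
    (m₁ : (Fin p → ℝ) → ℝ) (hm₁ : IsCondVersion P X A Y m₁)
    (μ₀ : (Fin p → ℝ) → ℝ)
    (hμ₀ : IsCondVersion (P[|{ω | R ω = 1}]) X (fun ω => 1 - A ω) Y μ₀) :
    ∫ ω, (Y1 ω - Y0 ω) ∂(P[|{ω | R ω = 1}]) =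
      ∫ ω, R ω / q * (m₁ (X ω) - μ₀ (X ω)) ∂P := by
  have hs : MeasurableSet {ω | R ω = 1} := hR (measurableSet_singleton 1)
  have hac : P[|{ω | R ω = 1}] ≪ P := cond_absolutelyContinuous
  have hbQ := hac.ae_le hbd
  have tr := integral_cond_R P R hR hR01 q hq hq0
  have hint : ∀ f : Ω → ℝ, Integrable f P → Integrable f (P[|{ω | R ω = 1}]) := by
    intro f hf
    refine (hf.restrict (s := {ω | R ω = 1})).smul_measure ?_
    rw [hq]
    simpa using hq0
  have hRA : ∀ᵐ ω ∂P, R ω * A ω = A ω := by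
    filter_upwards [hAR] with ω h
    rcases hA01 ω with a | a <;> rcases hR01 ω with r | r <;> simp_all <;> linarith
  have hv1 : IsCondVersion (P[|{ω | R ω = 1}]) X A Y1 m₁ := by
    refine ⟨hm₁.1, fun h hh hb => ?_⟩
    rw [tr, tr]
    have e := hm₁.2 h hh hb
    have l : ∫ ω, R ω / q * (A ω * Y1 ω * h (X ω)) ∂P
        = q⁻¹ * ∫ ω, A ω * Y ω * h (X ω) ∂P := by
      rw [← integral_const_mul]
      refine integral_congr_ae ?_
      filter_upwards [hRA] with ω r
      have : A ω * Y ω = A ω * Y1 ω := by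
        rw [hY]; rcases hA01 ω with a | a <;> simp [a]
      rw [this]
      calc _ = q⁻¹ * (R ω * A ω * Y1 ω * h (X ω)) := by ring
        _ = _ := by rw [r]
    have l2 : ∫ ω, R ω / q * (A ω * m₁ (X ω) * h (X ω)) ∂P
        = q⁻¹ * ∫ ω, A ω * m₁ (X ω) * h (X ω) ∂P := by
      rw [← integral_const_mul]
      refine integral_congr_ae ?_
      filter_upwards [hRA] with ω r
      calc _ = q⁻¹ * (R ω * A ω * m₁ (X ω) * h (X ω)) := by ring
        _ = _ := by rw [r]
    rw [l, l2, e]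
  have hv0 : IsCondVersion (P[|{ω | R ω = 1}]) X (fun ω => 1 - A ω) Y0 μ₀ := by
    refine ⟨hμ₀.1, fun h hh hb => ?_⟩
    rw [← hμ₀.2 h hh hb]
    congr 1; ext ω
    rw [hY]; rcases hA01 ω with a | a <;> simp [a]
  have he0 : IsCondVersion (P[|{ω | R ω = 1}]) X (fun _ => 1) (fun ω => 1 - A ω)
      (fun x => 1 - e₁ x) := by
    refine ⟨measurable_const.sub he₁.1, fun h hh hb => ?_⟩
    have e := he₁.2 h hh hb
    obtain ⟨C, hC⟩ := hb
    have hhi : Integrable (fun ω => h (X ω)) (P[|{ω | R ω = 1}]) :=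
      Integrable.of_bound (hh.comp hX).aestronglyMeasurable C
        (Filter.Eventually.of_forall fun ω => hC _)
    have i1 : Integrable (fun ω => 1 * A ω * h (X ω)) (P[|{ω | R ω = 1}]) := by
      refine hhi.bdd_mul (c := 1) (by fun_prop) (Filter.Eventually.of_forall fun ω => ?_)
      rcases hA01 ω with a | a <;> simp [a]
    have i2 : Integrable (fun ω => 1 * e₁ (X ω) * h (X ω)) (P[|{ω | R ω = 1}]) := by
      have := he₁.1
      refine hhi.bdd_mul (c := 1)
        (measurable_const.mul (he₁.1.comp hX)).aestronglyMeasurable ?_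
      filter_upwards [hbQ] with ω b
      rw [one_mul, Real.norm_eq_abs, abs_le]
      constructor <;> linarith [b.1.1, b.1.2, hδ.1]
    calc _ = ∫ ω, (h (X ω) - 1 * A ω * h (X ω)) ∂(P[|{ω | R ω = 1}]) := by
          congr 1; ext ω; ring
      _ = ∫ ω, (h (X ω) - 1 * e₁ (X ω) * h (X ω)) ∂(P[|{ω | R ω = 1}]) := by
          rw [integral_sub hhi i1, integral_sub hhi i2, e]
      _ = _ := by congr 1; ext ω; ring
  have c1 := version_eq_condExp (P[|{ω | R ω = 1}]) X hX A Y1 hA hY1m hA01 (hint _ hY1)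
    (hCI.comp measurable_id measurable_snd) e₁ he₁ δ hδ.1
    (by filter_upwards [hbQ] with ω b; exact ⟨b.1.1, by linarith [b.1.2, hδ.1]⟩) m₁ hv1
  have c0 := version_eq_condExp (P[|{ω | R ω = 1}]) X hX (fun ω => 1 - A ω) Y0
    (measurable_const.sub hA) hY0m
    (by intro ω; rcases hA01 ω with a | a <;> simp [a]) (hint _ hY0)
    (hCI.comp (measurable_const.sub measurable_id : Measurable fun a : ℝ => 1 - a) measurable_fst)
    (fun x => 1 - e₁ x) he0 δ hδ.1
    (by filter_upwards [hbQ] with ω b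
        exact ⟨by linarith [b.1.2], by linarith [b.1.1, hδ.1]⟩) μ₀ hv0
  rw [← tr, integral_sub (hint _ hY1) (hint _ hY0),
    integral_sub (integrable_condExp.congr c1.symm) (integrable_condExp.congr c0.symm),
    integral_congr_ae c1, integral_congr_ae c0, integral_condExp hX.comap_le,
    integral_condExp hX.comap_le]
end
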